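/- Let S' be any ℤ-submodule of the ℚ-span of S containing S such that ⟨u,v⟩ ∈ ℤ for all u,v ∈ S', ⟨u,u⟩ ∈ 2ℤ for all u ∈ S' (S' is an even overlattice of S), S' ∩ (ℚ-span of M) = M, and S' ∩ ℚℓ = ℤℓ. Then the index [S' : S] equals 1 or 2. Moreover, for every positive integer e such an S' of index 2 exists. -/

import Mathlib

/- Context: V ⊕ ℚℓ = ℚ^13, coordinates (m₁,…,m₈,n₁,…,n₄,ℓ) (indices 0,…,12),
Gram matrix -2·Id on 0,…,11 and ⟨ℓ,ℓ⟩ = 2e; M = M_{2,2} the exceptional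
lattice; S = M + ℤℓ. -/

noncomputable section
open Matrix

abbrev V : Type := Fin 13 → ℚ

def gramM (e : ℤ) : Matrix (Fin 13) (Fin 13) ℚ := Matrix.of fun i j =>
  if i = j then (if i.val = 12 then 2 * (e : ℚ) else -2) else 0

def B (e : ℤ) (u v : V) : ℚ := u ⬝ᵥ (gramM e *ᵥ v)

def bv : Fin 13 → V := fun i j => if i = j then 1 else 0

/-- μ₁ = (m₁+⋯+m₈)/2 -/
def μ₁ : V := (1/2 : ℚ) • (bv 0 + bv 1 + bv 2 + bv 3 + bv 4 + bv 5 + bv 6 + bv 7)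
/-- μ₂ = (n₁+n₂+n₃+n₄+m₁+m₂+m₇+m₈)/2 -/
def μ₂ : V := (1/2 : ℚ) • (bv 8 + bv 9 + bv 10 + bv 11 + bv 0 + bv 1 + bv 6 + bv 7)

/-- The exceptional lattice M = M_{2,2}. -/
def M : Submodule ℤ V :=
  Submodule.span ℤ ({bv 0, bv 1, bv 2, bv 3, bv 4, bv 5, bv 6, bv 7,
    bv 8, bv 9, bv 10, bv 11} ∪ {μ₁, μ₂})

/-- the polarization class ℓ with ℓ² = 2e -/
def ℓv : V := bv 12

/-- S = M ⊕ ℤℓ -/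
def S : Submodule ℤ V := M ⊔ Submodule.span ℤ {ℓv}

/-- S' is an admissible overlattice of S: an even overlattice of S inside the
ℚ-span of S, with S' ∩ (ℚ-span of M) = M and S' ∩ ℚℓ = ℤℓ. -/
def IsAdmissible (e : ℤ) (S' : Submodule ℤ V) : Prop :=
  S ≤ S' ∧
  S' ≤ (Submodule.span ℚ (S : Set V)).restrictScalars ℤ ∧
  (∀ u ∈ S', ∀ v ∈ S', ∃ n : ℤ, B e u v = (n : ℚ)) ∧
  (∀ u ∈ S', ∃ n : ℤ, B e u u = 2 * (n : ℚ)) ∧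
  S' ⊓ (Submodule.span ℚ (M : Set V)).restrictScalars ℤ = M ∧
  S' ⊓ (Submodule.span ℚ {ℓv}).restrictScalars ℤ = Submodule.span ℤ {ℓv}

/-- the index [S' : S] -/
def idx (S' : Submodule ℤ V) : ℕ :=
  Nat.card (↥S' ⧸ Submodule.comap S'.subtype S)

/-- `B` as a weighted sum of coordinate products. -/
theorem B_apply (e : ℤ) (u v : V) :
    B e u v = ∑ i, (if i.val = 12 then 2 * (e : ℚ) else -2) * (u i * v i) := by
  simp only [B, dotProduct, Matrix.mulVec, gramM, Matrix.of_apply]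
  refine Finset.sum_congr rfl fun i _ => ?_
  simp only [ite_mul, zero_mul, Finset.sum_ite_eq, Finset.mem_univ, if_true]
  split_ifs <;> ring

theorem B_comm (e : ℤ) (u v : V) : B e u v = B e v u := by
  simp only [B_apply, mul_comm (u _)]

theorem B_add_left (e : ℤ) (u v w : V) : B e (u + v) w = B e u w + B e v w := by
  simp [B]

theorem B_add_right (e : ℤ) (u v w : V) : B e u (v + w) = B e u v + B e u w := by
  simp [B, Matrix.mulVec_add]

theorem B_zsmul_left (e k : ℤ) (u v : V) : B e (k • u) v = k * B e u v := by
  rw [B, ← Int.cast_smul_eq_zsmul ℚ, smul_dotProduct, smul_eq_mul, B]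

theorem B_bv_left (e : ℤ) (i : Fin 13) (v : V) :
    B e (bv i) v = (if i.val = 12 then 2 * (e : ℚ) else -2) * v i := by
  simp [B_apply, bv]

/-- The set of generators of `S`. -/
def gens : Set V := Set.range bv ∪ {μ₁, μ₂}

theorem S_eq_span : S = Submodule.span ℤ gens := by
  apply le_antisymm
  · rw [S, M, ← Submodule.span_union, Submodule.span_le]
    intro v hv
    apply Submodule.subset_span
    simp only [Set.mem_union, Set.mem_insert_iff, Set.mem_singleton_iff, ℓv] at hv
    simp only [gens, Set.mem_union, Set.mem_range, Set.mem_insert_iff, Set.mem_singleton_iff]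
    grind
  · rw [S, M, ← Submodule.span_union]
    apply Submodule.span_mono
    rintro v (⟨i, rfl⟩ | h)
    · fin_cases i <;> simp [ℓv]
    · left; right; exact h

theorem apply_last_of_mem_M {v : V} (hv : v ∈ M) : v 12 = 0 := by
  refine Submodule.span_induction (p := fun v _ => v 12 = 0) ?_ rfl ?_ ?_ hv
  · intro v hv
    simp only [Set.mem_union, Set.mem_insert_iff, Set.mem_singleton_iff] at hv
    rcases hv with (h | h | h | h | h | h | h | h | h | h | h | h) | h | h <;>
      simp [h, bv, μ₁, μ₂, Fin.ext_iff]
  · intro x y _ _ hx hy; simp [hx, hy]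
  · intro a x _ hx; simp [hx]

theorem exists_of_mem_S {v : V} (hv : v ∈ S) : ∃ m ∈ M, ∃ k : ℤ, v = m + k • ℓv := by
  obtain ⟨m, hm, y, hy, rfl⟩ := Submodule.mem_sup.1 hv
  obtain ⟨k, rfl⟩ := Submodule.mem_span_singleton.1 hy
  exact ⟨m, hm, k, rfl⟩

theorem ℓv_apply_last : ℓv 12 = 1 := by simp [ℓv, bv]

theorem ℓv_apply_of_ne {i : Fin 13} (hi : i ≠ 12) : ℓv i = 0 := by simp [ℓv, bv, hi.symm]

theorem mem_span_M_of_apply_last {v : V} (hv : v 12 = 0) :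
    v ∈ Submodule.span ℚ (M : Set V) := by
  have h : v = ∑ i, v i • bv i := by
    ext j; simp [bv]
  rw [h]
  refine Submodule.sum_mem _ fun i _ => ?_
  by_cases hi : i = 12
  · subst hi; simp [hv]
  · refine Submodule.smul_mem _ _ (Submodule.subset_span (Submodule.subset_span ?_))
    left
    fin_cases i <;> simp at hi ⊢

theorem apply_last_of_mem_span_M {v : V} (hv : v ∈ Submodule.span ℚ (M : Set V)) :
    v 12 = 0 := by
  refine Submodule.span_induction (p := fun v _ => v 12 = 0) ?_ rfl ?_ ?_ hv
  · intro v hv; exact apply_last_of_mem_M hv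
  · intro x y _ _ hx hy; simp [hx, hy]
  · intro a x _ hx; simp [hx]

theorem M_le_S : M ≤ S := le_sup_left

theorem ℓv_mem_S : ℓv ∈ S := Submodule.mem_sup_right (Submodule.mem_span_singleton_self _)

theorem bv_mem_S (i : Fin 13) : bv i ∈ S := by
  rw [S_eq_span]; exact Submodule.subset_span (Or.inl ⟨i, rfl⟩)

theorem mem_span_ℚ_S (v : V) : v ∈ Submodule.span ℚ (S : Set V) := by
  have h : v = ∑ i, v i • bv i := by
    ext j; simp [bv]
  rw [h]
  exact Submodule.sum_mem _ fun i _ =>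
    Submodule.smul_mem _ _ (Submodule.subset_span (bv_mem_S i))

section Index

variable {e : ℤ} {S' : Submodule ℤ V}

theorem IsAdmissible.exists_two_mul_apply_last (h : IsAdmissible e S') {u : V} (hu : u ∈ S') :
    ∃ k : ℤ, 2 * u 12 = k := by
  obtain ⟨hS, -, hint, -, -, hℓ⟩ := h
  have h1 : ∀ i : Fin 13, i ≠ 12 → ∃ k : ℤ, 2 * u i = k := by
    intro i hi
    obtain ⟨n, hn⟩ := hint _ (hS (bv_mem_S i)) u hu
    rw [B_bv_left, if_neg fun h : i.val = 12 => hi (Fin.ext h)] at hn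
    exact ⟨-n, by push_cast; linarith⟩
  choose! a ha using h1
  have h2 : (2 * u 12) • ℓv = (2 : ℤ) • u - ∑ i, a i • bv i + a 12 • ℓv := by
    ext j
    by_cases hj : j = 12
    · subst hj
      simp [ℓv, bv, Finset.sum_apply]
    · simp [ℓv_apply_of_ne hj, bv, Finset.sum_apply, ha j hj]
  have h3 : (2 * u 12) • ℓv ∈ S' ⊓ (Submodule.span ℚ {ℓv}).restrictScalars ℤ := by
    refine ⟨?_, Submodule.smul_mem _ _ (Submodule.mem_span_singleton_self _)⟩
    rw [h2]
    exact S'.add_mem (S'.sub_mem (S'.smul_mem _ hu)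
      (S'.sum_mem fun i _ => S'.smul_mem _ (hS (bv_mem_S i)))) (S'.smul_mem _ (hS ℓv_mem_S))
  rw [hℓ] at h3
  obtain ⟨k, hk⟩ := Submodule.mem_span_singleton.1 h3
  refine ⟨k, ?_⟩
  have := congrFun hk 12
  simp only [Pi.smul_apply, ℓv_apply_last, smul_eq_mul, mul_one, zsmul_eq_mul] at this
  exact this.symm

theorem IsAdmissible.mem_S_of_apply_last (h : IsAdmissible e S') {u : V} (hu : u ∈ S')
    {k : ℤ} (hk : u 12 = k) : u ∈ S := by
  obtain ⟨hS, -, -, -, hM, -⟩ := h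
  have h1 : u - k • ℓv ∈ S' ⊓ (Submodule.span ℚ (M : Set V)).restrictScalars ℤ :=
    ⟨S'.sub_mem hu (S'.smul_mem _ (hS ℓv_mem_S)),
      mem_span_M_of_apply_last (by simp [ℓv_apply_last, hk])⟩
  rw [hM] at h1
  simpa using S.add_mem (M_le_S h1) (S.smul_mem k ℓv_mem_S)

theorem idx_eq_one_iff : idx S' = 1 ↔ S' ≤ S := by
  change (Submodule.comap S'.subtype S).toAddSubgroup.index = 1 ↔ _
  rw [AddSubgroup.index_eq_one, AddSubgroup.eq_top_iff']
  exact ⟨fun h x hx => h ⟨x, hx⟩, fun h x => h x.2⟩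

theorem IsAdmissible.idx_eq (h : IsAdmissible e S') : idx S' = 1 ∨ idx S' = 2 := by
  by_cases hle : S' ≤ S
  · exact Or.inl (idx_eq_one_iff.2 hle)
  right
  obtain ⟨a, ha, haS⟩ := Set.not_subset.1 hle
  change (Submodule.comap S'.subtype S).toAddSubgroup.index = 2
  rw [AddSubgroup.index_eq_two_iff]
  refine ⟨⟨a, ha⟩, fun ⟨b, hb⟩ => ?_⟩
  change Xor (b + a ∈ S) (b ∈ S)
  by_cases hbS : b ∈ S
  · exact Or.inr ⟨hbS, fun hab => haS (by simpa using S.sub_mem hab hbS)⟩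
  · refine Or.inl ⟨?_, hbS⟩
    have key : ∀ u ∈ S', u ∉ S → ∃ k : ℤ, u 12 = k + 1 / 2 := by
      intro u hu huS
      obtain ⟨k, hk⟩ := h.exists_two_mul_apply_last hu
      rcases Int.even_or_odd' k with ⟨c, rfl | rfl⟩
      · exact absurd (h.mem_S_of_apply_last hu (k := c) (by push_cast at hk; linarith)) huS
      · exact ⟨c, by push_cast at hk; linarith⟩
    obtain ⟨k, hk⟩ := key a ha haS
    obtain ⟨l, hl⟩ := key b hb hbS
    refine h.mem_S_of_apply_last (S'.add_mem hb ha) (k := l + k + 1) ?_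
    simp only [Pi.add_apply, hk, hl]
    push_cast
    ring

end Index

section Existence

theorem exists_int_of_mem_span {e : ℤ} {G : Set V}
    (hG : ∀ u ∈ G, ∀ v ∈ G, ∃ n : ℤ, B e u v = n) {u v : V}
    (hu : u ∈ Submodule.span ℤ G) (hv : v ∈ Submodule.span ℤ G) :
    ∃ n : ℤ, B e u v = n := by
  induction hu, hv using Submodule.span_induction₂ with
  | mem_mem x y hx hy => exact hG x hx y hy
  | zero_left y _ => exact ⟨0, by simp [B]⟩
  | zero_right x _ => exact ⟨0, by simp [B]⟩
  | add_left x y z _ _ _ h₁ h₂ =>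
    obtain ⟨m, hm⟩ := h₁
    obtain ⟨n, hn⟩ := h₂
    exact ⟨m + n, by rw [B_add_left, hm, hn]; push_cast; rfl⟩
  | add_right x y z _ _ _ h₁ h₂ =>
    obtain ⟨m, hm⟩ := h₁
    obtain ⟨n, hn⟩ := h₂
    exact ⟨m + n, by rw [B_add_right, hm, hn]; push_cast; rfl⟩
  | smul_left r x y _ _ h =>
    obtain ⟨m, hm⟩ := h
    exact ⟨r * m, by rw [B_zsmul_left, hm]; push_cast; rfl⟩
  | smul_right r x y _ _ h =>
    obtain ⟨m, hm⟩ := h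
    exact ⟨r * m, by rw [B_comm, B_zsmul_left, B_comm, hm]; push_cast; rfl⟩

theorem exists_even_of_mem_span {e : ℤ} {G : Set V}
    (hG : ∀ u ∈ G, ∀ v ∈ G, ∃ n : ℤ, B e u v = n)
    (hG' : ∀ u ∈ G, ∃ n : ℤ, B e u u = 2 * n) {u : V}
    (hu : u ∈ Submodule.span ℤ G) : ∃ n : ℤ, B e u u = 2 * n := by
  induction hu using Submodule.span_induction with
  | mem x hx => exact hG' x hx
  | zero => exact ⟨0, by simp [B]⟩
  | add x y hx hy h₁ h₂ =>
    obtain ⟨m, hm⟩ := h₁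
    obtain ⟨n, hn⟩ := h₂
    obtain ⟨k, hk⟩ := exists_int_of_mem_span hG hx hy
    refine ⟨m + n + k, ?_⟩
    rw [B_add_left, B_add_right, B_add_right, B_comm e y x, hm, hn, hk]
    push_cast
    ring
  | smul r x _ h =>
    obtain ⟨m, hm⟩ := h
    refine ⟨r * r * m, ?_⟩
    rw [B_zsmul_left, B_comm, B_zsmul_left, hm]
    push_cast
    ring

theorem B_eq_coords (e : ℤ) (u v : V) :
    B e u v = -2 * (u 0 * v 0 + u 1 * v 1 + u 2 * v 2 + u 3 * v 3 + u 4 * v 4 + u 5 * v 5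
      + u 6 * v 6 + u 7 * v 7 + u 8 * v 8 + u 9 * v 9 + u 10 * v 10 + u 11 * v 11)
      + 2 * e * (u 12 * v 12) := by
  rw [B_apply]
  simp [Fin.sum_univ_succ]
  ring

theorem μ₁_eq : μ₁ = ![1/2, 1/2, 1/2, 1/2, 1/2, 1/2, 1/2, 1/2, 0, 0, 0, 0, 0] := by
  ext i
  fin_cases i <;> simp [μ₁, bv, Fin.ext_iff]

theorem μ₂_eq : μ₂ = ![1/2, 1/2, 0, 0, 0, 0, 1/2, 1/2, 1/2, 1/2, 1/2, 1/2, 0] := by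
  ext i
  fin_cases i <;> simp [μ₂, bv, Fin.ext_iff]

/-- Elements of `S` differ by an integer in the coordinates `2` and `4`. -/
theorem exists_apply_two_sub_apply_four {v : V} (hv : v ∈ S) : ∃ k : ℤ, v 2 - v 4 = k := by
  rw [S_eq_span] at hv
  induction hv using Submodule.span_induction with
  | mem x hx =>
    rcases hx with ⟨i, rfl⟩ | rfl | rfl
    · exact ⟨(if i = 2 then 1 else 0) - (if i = 4 then 1 else 0), by simp [bv]⟩
    · exact ⟨0, by simp [μ₁_eq]⟩
    · exact ⟨0, by simp [μ₂_eq]⟩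
  | zero => exact ⟨0, by simp⟩
  | add x y _ _ h₁ h₂ =>
    obtain ⟨m, hm⟩ := h₁
    obtain ⟨n, hn⟩ := h₂
    exact ⟨m + n, by push_cast; rw [← hm, ← hn]; simp only [Pi.add_apply]; ring⟩
  | smul r x _ h =>
    obtain ⟨m, hm⟩ := h
    exact ⟨r * m, by push_cast; rw [← hm]; simp only [Pi.smul_apply, zsmul_eq_mul]; ring⟩

theorem exists_isAdmissible_of_glue (e : ℤ) (x : Fin 13 → ℤ) (h2 : x 2 = 1) (h4 : x 4 = 0)
    (h12 : x 12 = 1)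
    (hμ₁ : 2 ∣ x 0 + x 1 + x 2 + x 3 + x 4 + x 5 + x 6 + x 7)
    (hμ₂ : 2 ∣ x 0 + x 1 + x 6 + x 7 + x 8 + x 9 + x 10 + x 11)
    (hx : 4 ∣ e - (x 0 ^ 2 + x 1 ^ 2 + x 2 ^ 2 + x 3 ^ 2 + x 4 ^ 2 + x 5 ^ 2 + x 6 ^ 2
      + x 7 ^ 2 + x 8 ^ 2 + x 9 ^ 2 + x 10 ^ 2 + x 11 ^ 2)) :
    ∃ S' : Submodule ℤ V, IsAdmissible e S' ∧ ¬ S' ≤ S := by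
  set w : V := fun i => (x i : ℚ) / 2 with hw
  have hw_mem : (2 : ℤ) • w ∈ S := by
    have h : (2 : ℤ) • w = ∑ i, x i • bv i := by
      ext j
      simp [hw, bv, Finset.sum_apply]
      ring
    rw [h]
    exact S.sum_mem fun i _ => S.smul_mem _ (bv_mem_S i)
  have hspan : S ⊔ Submodule.span ℤ {w} = Submodule.span ℤ (gens ∪ {w}) := by
    rw [S_eq_span, Submodule.span_union]
  have hmem : ∀ v ∈ S ⊔ Submodule.span ℤ {w}, ∃ s ∈ S, ∃ k : ℤ, v = s + k • w := by
    intro v hv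
    obtain ⟨s, hs, y, hy, rfl⟩ := Submodule.mem_sup.1 hv
    obtain ⟨k, rfl⟩ := Submodule.mem_span_singleton.1 hy
    exact ⟨s, hs, k, rfl⟩
  have hcase : ∀ v ∈ S ⊔ Submodule.span ℤ {w}, v ∈ S ∨ ∃ s ∈ S, v = s + w := by
    intro v hv
    obtain ⟨s, hs, k, rfl⟩ := hmem v hv
    rcases Int.even_or_odd' k with ⟨c, rfl | rfl⟩
    · left
      rw [mul_comm, mul_smul]
      exact S.add_mem hs (S.smul_mem _ hw_mem)
    · right
      refine ⟨s + c • (2 : ℤ) • w, S.add_mem hs (S.smul_mem _ hw_mem), ?_⟩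
      module
  have hlast : ∀ s ∈ S, ∃ k : ℤ, s 12 = k := by
    intro s hs
    obtain ⟨m, hm, k, rfl⟩ := exists_of_mem_S hs
    exact ⟨k, by simp [apply_last_of_mem_M hm, ℓv_apply_last]⟩
  have hw12 : w 12 = 1 / 2 := by simp [hw, h12]
  have half : ∀ k : ℤ, (k : ℚ) + 1 / 2 ≠ 0 := by
    intro k hk
    have : ((2 * k + 1 : ℤ) : ℚ) = 0 := by push_cast; linarith
    have := Int.cast_eq_zero.1 this
    omega
  have hhalf : ∀ g ∈ gens ∪ {w}, ∀ i, ∃ k : ℤ, 2 * g i = k := by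
    rintro g ((⟨j, rfl⟩ | rfl | rfl) | rfl) i
    · exact ⟨2 * if j = i then 1 else 0, by simp [bv]⟩
    · rw [μ₁_eq]
      fin_cases i <;> first | (use 1; simp; done) | (use 0; simp)
    · rw [μ₂_eq]
      fin_cases i <;> first | (use 1; simp; done) | (use 0; simp)
    · exact ⟨x i, by simp [hw]; ring⟩
  have hbv : ∀ i, ∀ g ∈ gens ∪ {w}, ∃ n : ℤ, B e (bv i) g = n := by
    intro i g hg
    obtain ⟨k, hk⟩ := hhalf g hg i
    rw [B_bv_left]
    split_ifs
    · exact ⟨e * k, by push_cast; rw [← hk]; ring⟩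
    · exact ⟨-k, by push_cast; rw [← hk]; ring⟩
  obtain ⟨c₁, hc₁⟩ := hμ₁
  obtain ⟨c₂, hc₂⟩ := hμ₂
  obtain ⟨c₃, hc₃⟩ := hx
  have b11 : B e μ₁ μ₁ = 2 * (-2 : ℤ) := by rw [B_eq_coords, μ₁_eq]; simp; norm_num
  have b12 : B e μ₁ μ₂ = (-2 : ℤ) := by rw [B_eq_coords, μ₁_eq, μ₂_eq]; simp; norm_num
  have b22 : B e μ₂ μ₂ = 2 * (-2 : ℤ) := by rw [B_eq_coords, μ₂_eq]; simp; norm_num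
  have b1w : B e μ₁ w = (-c₁ : ℤ) := by
    have := congrArg (Int.cast : ℤ → ℚ) hc₁
    push_cast at this ⊢
    rw [B_eq_coords, μ₁_eq]
    simp [hw]
    linarith
  have b2w : B e μ₂ w = (-c₂ : ℤ) := by
    have := congrArg (Int.cast : ℤ → ℚ) hc₂
    push_cast at this ⊢
    rw [B_eq_coords, μ₂_eq]
    simp [hw]
    linarith
  have bww : B e w w = 2 * (c₃ : ℤ) := by
    have := congrArg (Int.cast : ℤ → ℚ) hc₃
    push_cast at this ⊢
    rw [B_eq_coords]
    simp only [hw, h12]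
    push_cast
    linarith
  have hint : ∀ u ∈ gens ∪ {w}, ∀ v ∈ gens ∪ {w}, ∃ n : ℤ, B e u v = n := by
    rintro u hu v hv
    rcases id hu with (⟨j, rfl⟩ | rfl | rfl) | rfl
    · exact hbv j v hv
    all_goals
      rcases id hv with (⟨j, rfl⟩ | rfl | rfl) | rfl
      · rw [B_comm]; exact hbv j _ hu
      all_goals
        first
        | exact ⟨_, b12⟩ | exact ⟨_, b1w⟩ | exact ⟨_, b2w⟩
        | exact ⟨_, (B_comm _ _ _).trans b12⟩ | exact ⟨_, (B_comm _ _ _).trans b1w⟩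
        | exact ⟨_, (B_comm _ _ _).trans b2w⟩
        | exact ⟨2 * (-2), by rw [b11]; norm_num⟩
        | exact ⟨2 * (-2), by rw [b22]; norm_num⟩
        | exact ⟨2 * c₃, by rw [bww]; norm_num⟩
  have heven : ∀ u ∈ gens ∪ {w}, ∃ n : ℤ, B e u u = 2 * n := by
    rintro u ((⟨j, rfl⟩ | rfl | rfl) | rfl)
    · rw [B_bv_left]
      split_ifs
      · exact ⟨e, by simp [bv]⟩
      · exact ⟨-1, by simp [bv]⟩
    exacts [⟨_, b11⟩, ⟨_, b22⟩, ⟨_, bww⟩]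
  refine ⟨S ⊔ Submodule.span ℤ {w}, ⟨le_sup_left, fun v _ => mem_span_ℚ_S v, ?_, ?_, ?_, ?_⟩, ?_⟩
  · rw [hspan]
    exact fun u hu v hv => exists_int_of_mem_span hint hu hv
  · rw [hspan]
    exact fun u hu => exists_even_of_mem_span hint heven hu
  · apply le_antisymm
    · rintro v ⟨hv, hvM⟩
      have hv0 : v 12 = 0 := apply_last_of_mem_span_M hvM
      rcases hcase v hv with hvS | ⟨s, hs, rfl⟩
      · obtain ⟨m, hm, k, rfl⟩ := exists_of_mem_S hvS
        have hk : k = 0 := by simpa [apply_last_of_mem_M hm, ℓv_apply_last] using hv0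
        simpa [hk] using hm
      · obtain ⟨k, hk⟩ := hlast s hs
        rw [Pi.add_apply, hk, hw12] at hv0
        exact absurd hv0 (half k)
    · exact fun v hv => ⟨le_sup_left (a := S) (M_le_S hv), Submodule.subset_span hv⟩
  · apply le_antisymm
    · rintro v ⟨hv, hvℓ⟩
      obtain ⟨c, rfl⟩ := Submodule.mem_span_singleton.1 hvℓ
      rcases hcase _ hv with hvS | ⟨s, hs, hsw⟩
      · obtain ⟨k, hk⟩ := hlast _ hvS
        refine Submodule.mem_span_singleton.2 ⟨k, ?_⟩
        have hc : c = k := by simpa [ℓv_apply_last] using hk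
        rw [hc, Int.cast_smul_eq_zsmul]
      · obtain ⟨k, hk⟩ := exists_apply_two_sub_apply_four hs
        have e2 := congrFun hsw 2
        have e4 := congrFun hsw 4
        simp [ℓv_apply_of_ne, hw, h2, h4] at e2 e4
        exact absurd (by linarith) (half k)
    · intro v hv
      obtain ⟨k, rfl⟩ := Submodule.mem_span_singleton.1 hv
      refine ⟨Submodule.smul_mem _ _ (le_sup_left (a := S) ℓv_mem_S), ?_⟩
      exact Submodule.smul_of_tower_mem _ k (Submodule.mem_span_singleton_self _)
  · intro hle
    obtain ⟨k, hk⟩ := hlast w (hle (Submodule.mem_sup_right (Submodule.mem_span_singleton_self _)))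
    apply half (-k)
    push_cast
    rw [← hk, hw12]
    norm_num

theorem exists_isAdmissible_not_le (e : ℤ) :
    ∃ S' : Submodule ℤ V, IsAdmissible e S' ∧ ¬ S' ≤ S := by
  have h : e % 4 = 0 ∨ e % 4 = 1 ∨ e % 4 = 2 ∨ e % 4 = 3 := by omega
  rcases h with h | h | h | h
  · apply exists_isAdmissible_of_glue e ![0, 0, 1, 1, 0, 0, 0, 0, 1, 1, 0, 0, 1] <;> simp <;> omega
  · apply exists_isAdmissible_of_glue e ![1, 1, 1, 0, 0, 0, 1, 0, 1, 0, 0, 0, 1] <;> simp <;> omega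
  · apply exists_isAdmissible_of_glue e ![0, 0, 1, 1, 0, 0, 0, 0, 0, 0, 0, 0, 1] <;> simp <;> omega
  · apply exists_isAdmissible_of_glue e ![1, 0, 1, 0, 0, 0, 0, 0, 1, 0, 0, 0, 1] <;> simp <;> omega

end Existence

/-- any admissible even overlattice S' of S = M_{2,2} ⊕ ⟨2e⟩ has
index 1 or 2 over S, and for every positive e one of index 2 exists. -/
theorem stmt14 (e : ℤ) (he : 0 < e) :
    (∀ S' : Submodule ℤ V, IsAdmissible e S' → idx S' = 1 ∨ idx S' = 2) ∧
    (∃ S' : Submodule ℤ V, IsAdmissible e S' ∧ idx S' = 2) := by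
  refine ⟨fun S' h => h.idx_eq, ?_⟩
  obtain ⟨S', h, hle⟩ := exists_isAdmissible_not_le e
  exact ⟨S', h, h.idx_eq.resolve_left fun h1 => hle (idx_eq_one_iff.1 h1)⟩
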